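/- arXiv:1801.06909 — 3 statements merged into one kernel-verified Lean document; each statement's English description precedes it below -/
import Mathlib

section
/- Let O be a generic type C column sequence. Then every member of Norm(O) is again a type C column sequence (weakly decreasing, with nonnegative entries and with c'_{2i} + c'_{2i+1} even for every i) with the same total sum as O; in particular, every fundamental degeneration performed in the construction of Norm(O) is legitimate, i.e. the replaced quadruple stays weakly decreasing relative to its neighboring entries and the entries lowered by 1 are at least 1. -/
/-- A type C column sequence: weakly decreasing, even length, and each
consecutive pair `(c_{2i}, c_{2i+1})` has even sum. -/
def TypeC (c : List ℕ) : Prop :=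
  Even c.length ∧ c.Chain' (· ≥ ·) ∧
    ∀ i, 2 * i + 1 < c.length → Even (c.getD (2 * i) 0 + c.getD (2 * i + 1) 0)

/-- A chain `[b_0, b_1, …, b_{2k+1}]`: nonempty, of even length, weakly
decreasing, with `b_{2i-1} = b_{2i}` for `1 ≤ i ≤ k`. -/
def IsChainSeq (b : List ℕ) : Prop :=
  b ≠ [] ∧ Even b.length ∧ b.Chain' (· ≥ ·) ∧
    ∀ i, 2 * i + 2 < b.length → b.getD (2 * i + 1) 0 = b.getD (2 * i + 2) 0

/-- The chain decomposition of a column sequence: cut after each odd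
position `2q+1` such that `c_{2q+1} > c_{2q+2}`. -/
def chains : List ℕ → List (List ℕ)
  | a :: b :: rest =>
    match chains rest with
    | [] => [[a, b]]
    | C :: L => if C.headI < b then [a, b] :: C :: L else (a :: b :: C) :: L
  | _ => []

/-- A chain is generic if it is `[b_0 = b_1]` (length 2 with equal entries)
or has length `≥ 4` and `b_{2i} > b_{2i+1}` for all `i`. -/
def GenericChain (b : List ℕ) : Prop :=
  (b.length = 2 ∧ b.getD 0 0 = b.getD 1 0) ∨
  (4 ≤ b.length ∧ ∀ i, 2 * i + 1 < b.length → b.getD (2 * i + 1) 0 < b.getD (2 * i) 0)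

/-- A column sequence is generic if all of its chains are generic. -/
def GenericSeq (c : List ℕ) : Prop := ∀ C ∈ chains c, GenericChain C

/-- The fundamental degeneration of a quadruple `b_0 ≥ b_1 = b_2 ≥ b_3`. -/
def fundDeg (b0 b1 b2 b3 : ℕ) : ℕ × ℕ × ℕ × ℕ :=
  if b0 = b1 then
    if b2 = b3 then (b0 + 1, b1 + 1, b2 - 1, b3 - 1)
    else (b0 + 1, b1 + 1, b2 - 2, b3)
  else
    if b2 = b3 then (b0, b1 + 2, b2 - 1, b3 - 1)
    else (b0, b1 + 2, b2 - 2, b3)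

/-- Replacement of the four consecutive entries at positions
`2i, 2i+1, 2i+2, 2i+3` by their fundamental degeneration, deleting the
last two entries if the two lowered entries both become `0`. -/
def degenAt (c : List ℕ) (i : ℕ) : List ℕ :=
  let q := fundDeg (c.getD (2 * i) 0) (c.getD (2 * i + 1) 0)
    (c.getD (2 * i + 2) 0) (c.getD (2 * i + 3) 0)
  let c' := c.take (2 * i) ++ [q.1, q.2.1, q.2.2.1, q.2.2.2] ++ c.drop (2 * i + 4)
  if q.2.2.1 = 0 ∧ q.2.2.2 = 0 then c'.dropLast.dropLast else c'

/-- `Norm(O)`: the smallest collection containing `O` and closed under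
fundamental degeneration at an interior pair of a chain (the positions
`(2i+1, 2i+2)` carry an interior pair of a chain exactly when the two
entries there are equal). -/
inductive NormMem (O : List ℕ) : List ℕ → Prop
  | base : NormMem O O
  | step (c : List ℕ) (i : ℕ) : NormMem O c → 2 * i + 3 < c.length →
      c.getD (2 * i + 1) 0 = c.getD (2 * i + 2) 0 → NormMem O (degenAt c i)

theorem chains_head (x y : ℕ) (r : List ℕ) :
    ∃ D L, chains (x :: y :: r) = (x :: y :: D) :: L := by
  rw [chains]
  split
  · exact ⟨[], [], rfl⟩
  · rename_i C L _
    split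
    · exact ⟨[], C :: L, rfl⟩
    · exact ⟨C, L, rfl⟩

theorem strict_of_chains : ∀ (c : List ℕ),
    (∀ D ∈ chains c, D.length = 2 ∨
      ∀ i, 2 * i + 1 < D.length → D.getD (2 * i + 1) 0 < D.getD (2 * i) 0) →
    ∀ i, 2 * i + 3 < c.length → c.getD (2 * i + 1) 0 = c.getD (2 * i + 2) 0 →
      c.getD (2 * i + 1) 0 < c.getD (2 * i) 0 ∧ c.getD (2 * i + 3) 0 < c.getD (2 * i + 2) 0
  | [], _, i, hi, _ => by simp at hi
  | [_], _, i, hi, _ => by simp at hi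
  | [_, _], _, i, hi, _ => by simp at hi
  | [_, _, _], _, i, hi, _ => by simp at hi
  | a :: b :: x :: y :: r, hW, i, hi, he => by
    obtain ⟨D, L, hD⟩ := chains_head x y r
    rw [chains, hD] at hW
    change ∀ D_1 ∈ (if x < b then [a, b] :: (x :: y :: D) :: L
      else (a :: b :: x :: y :: D) :: L), _ at hW
    cases i with
    | zero =>
      have he' : b = x := by simpa using he
      subst he'
      simp only [lt_irrefl, if_false] at hW
      have h := hW _ (List.mem_cons_self)
      rcases h with h | h
      · simp at h
      · have h0 := h 0 (by simp)
        have h1 := h 1 (by simp)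
        simp at h0 h1 ⊢
        exact ⟨h0, h1⟩
    | succ i =>
      have ih := strict_of_chains (x :: y :: r) ?_ i (by simp at hi ⊢; omega)
        (by simpa [Nat.mul_add] using he)
      · simpa [Nat.mul_add] using ih
      · rw [hD]
        intro E hE
        by_cases hlt : x < b
        · rw [if_pos hlt] at hW
          exact hW E (List.mem_cons_of_mem _ hE)
        · rw [if_neg hlt] at hW
          rcases List.mem_cons.1 hE with rfl | hE
          · right
            rcases hW _ (List.mem_cons_self) with h | h
            · simp at h
            · intro j hj
              have := h (j + 1) (by simp at hj ⊢; omega)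
              simpa [Nat.mul_add] using this
          · exact hW E (List.mem_cons_of_mem _ hE)

theorem dec_iff (c : List ℕ) :
    c.IsChain (· ≥ ·) ↔ ∀ j, c.getD (j + 1) 0 ≤ c.getD j 0 := by
  rw [List.isChain_iff_getElem]
  constructor
  · intro h j
    by_cases hj : j + 1 < c.length
    · have := h j hj
      rw [List.getD_eq_getElem _ _ hj, List.getD_eq_getElem _ _ (by omega)]
      exact this
    · rw [List.getD_eq_default _ _ (by omega)]
      exact Nat.zero_le _
  · intro h j hj
    have := h j
    rw [List.getD_eq_getElem _ _ hj, List.getD_eq_getElem _ _ (by omega)] at this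
    exact this

theorem sum_getD (c : List ℕ) : ∀ N, c.length ≤ N →
    c.sum = ∑ j ∈ Finset.range N, c.getD j 0 := by
  induction c with
  | nil => intro N _; simp
  | cons a t ih =>
    intro N hN
    cases N with
    | zero => simp at hN
    | succ N =>
      rw [Finset.sum_range_succ', List.sum_cons, ih N (by simpa using hN)]
      simp [add_comm]

theorem sum_split (F : ℕ → ℕ) (n m : ℕ) : ∑ j ∈ Finset.range (n + 4 + m), F j =
    (∑ j ∈ Finset.range n, F j + F n + F (n + 1) + F (n + 2) + F (n + 3)) +
      ∑ j ∈ Finset.range m, F (n + 4 + j) := by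
  rw [Finset.sum_range_add (n := n + 4), Finset.sum_range_succ, Finset.sum_range_succ,
    Finset.sum_range_succ, Finset.sum_range_succ]

/-- value after replacing the quadruple at position `2i` -/
def upd (f : ℕ → ℕ) (i : ℕ) (q : ℕ × ℕ × ℕ × ℕ) (j : ℕ) : ℕ :=
  if j = 2 * i then q.1 else if j = 2 * i + 1 then q.2.1 else
  if j = 2 * i + 2 then q.2.2.1 else if j = 2 * i + 3 then q.2.2.2 else f j

theorem getD_replace (c : List ℕ) (i : ℕ) (hi : 2 * i + 3 < c.length) (q : ℕ × ℕ × ℕ × ℕ) (j : ℕ) :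
    (c.take (2 * i) ++ [q.1, q.2.1, q.2.2.1, q.2.2.2] ++ c.drop (2 * i + 4)).getD j 0
      = upd (fun j => c.getD j 0) i q j := by
  unfold upd
  have hl : (c.take (2 * i)).length = 2 * i := by simp; omega
  rcases lt_or_ge j (2 * i) with h | h
  · rw [List.append_assoc, List.getD_append _ _ _ _ (by omega)]
    rw [if_neg (by omega), if_neg (by omega), if_neg (by omega), if_neg (by omega)]
    simp [List.getD_eq_getElem?_getD, List.getElem?_take, h]
  · obtain ⟨k, rfl⟩ := Nat.exists_eq_add_of_le h
    rw [List.append_assoc, List.getD_append_right _ _ _ _ (by omega), hl]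
    rw [show 2 * i + k - 2 * i = k by omega]
    match k with
    | 0 => simp
    | 1 => simp
    | 2 => simp
    | 3 => simp
    | k + 4 =>
      rw [if_neg (by omega), if_neg (by omega), if_neg (by omega), if_neg (by omega)]
      simp [List.getD_eq_getElem?_getD, List.getElem?_drop]
      congr 2
      omega

theorem degenAt_spec (c : List ℕ) (i : ℕ) (hi : 2 * i + 3 < c.length) (hev : Even c.length)
    (q : ℕ × ℕ × ℕ × ℕ)
    (hq : q = fundDeg (c.getD (2 * i) 0) (c.getD (2 * i + 1) 0)
      (c.getD (2 * i + 2) 0) (c.getD (2 * i + 3) 0))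
    (hdec : ∀ j, upd (fun j => c.getD j 0) i q (j + 1) ≤ upd (fun j => c.getD j 0) i q j)
    (hs : q.1 + q.2.1 + q.2.2.1 + q.2.2.2 = c.getD (2 * i) 0 + c.getD (2 * i + 1) 0 +
      c.getD (2 * i + 2) 0 + c.getD (2 * i + 3) 0) :
    (∀ j, (degenAt c i).getD j 0 = upd (fun j => c.getD j 0) i q j) ∧
    Even (degenAt c i).length ∧ (degenAt c i).sum = c.sum := by
  set c' := c.take (2 * i) ++ [q.1, q.2.1, q.2.2.1, q.2.2.2] ++ c.drop (2 * i + 4) with hc'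
  have hlen : c'.length = c.length := by simp [hc']; omega
  have hg : ∀ j, c'.getD j 0 = upd (fun j => c.getD j 0) i q j := getD_replace c i hi q
  have hd : degenAt c i = if q.2.2.1 = 0 ∧ q.2.2.2 = 0 then c'.dropLast.dropLast else c' := by
    rw [hc', hq]; rfl
  have main : (∀ j, (degenAt c i).getD j 0 = upd (fun j => c.getD j 0) i q j) ∧
      Even (degenAt c i).length ∧ (degenAt c i).length ≤ c.length := by
    rw [hd]
    split_ifs with h0
    · have hz : ∀ k, upd (fun j => c.getD j 0) i q (2 * i + 2 + k) = 0 := by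
        intro k
        induction k with
        | zero => simp [upd, h0.1]
        | succ k ih => have := hdec (2 * i + 2 + k); rw [ih] at this; exact Nat.le_zero.1 this
      refine ⟨fun j => ?_, ?_, ?_⟩
      · rw [← hg]
        rcases lt_or_ge j (c.length - 2) with h | h
        · have h1 : j < c'.length - 1 := by omega
          have h2 : j < c'.length - 1 - 1 := by omega
          rw [List.getD_eq_getElem _ _ (by simpa using h2), List.getD_eq_getElem _ _ (by omega)]
          simp
        · rw [List.getD_eq_default _ _ (by simp; omega), hg]
          have := hz (j - (2 * i + 2))
          rw [show 2 * i + 2 + (j - (2 * i + 2)) = j by omega] at this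
          exact this.symm
      · simp only [List.length_dropLast, hlen]
        rw [Nat.even_iff] at *; omega
      · simp only [List.length_dropLast, hlen]; omega
    · exact ⟨hg, hlen ▸ hev, hlen.le⟩
  refine ⟨main.1, main.2.1, ?_⟩
  rw [sum_getD _ _ main.2.2, sum_getD c _ le_rfl]
  obtain ⟨m, hm⟩ := Nat.exists_eq_add_of_le (show 2 * i + 4 ≤ c.length by omega)
  simp only [main.1]
  rw [hm, sum_split, sum_split]
  congr 1
  · have : ∑ x ∈ Finset.range (2 * i), upd (fun j => c.getD j 0) i q x
        = ∑ x ∈ Finset.range (2 * i), c.getD x 0 := by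
      refine Finset.sum_congr rfl fun x hx => ?_
      have := Finset.mem_range.1 hx
      unfold upd
      rw [if_neg (by omega), if_neg (by omega), if_neg (by omega), if_neg (by omega)]
    rw [this]
    have e0 : upd (fun j => c.getD j 0) i q (2 * i) = q.1 := by simp [upd]
    have e1 : upd (fun j => c.getD j 0) i q (2 * i + 1) = q.2.1 := by simp [upd]
    have e2 : upd (fun j => c.getD j 0) i q (2 * i + 2) = q.2.2.1 := by simp [upd]
    have e3 : upd (fun j => c.getD j 0) i q (2 * i + 3) = q.2.2.2 := by simp [upd]
    rw [e0, e1, e2, e3]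
    omega
  · refine Finset.sum_congr rfl fun x hx => ?_
    unfold upd
    rw [if_neg (by omega), if_neg (by omega), if_neg (by omega), if_neg (by omega)]

open Classical in
/-- even entry of a block `(a,b)` with left/right pair degenerated -/
noncomputable def evE (L R : Prop) (a b : ℕ) : ℕ :=
  if L then (if R ∧ a = b + 2 then a - 1 else a - 2) else a

open Classical in
/-- odd entry of a block -/
noncomputable def odE (L R : Prop) (a b : ℕ) : ℕ :=
  if R then (if L ∧ a = b + 2 then b + 1 else b + 2) else b

/-- shape of the members of the norm, as functions -/
structure Shape (f g : ℕ → ℕ) (T : ℕ → Prop) : Prop where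
  zero : ¬ T 0
  int : ∀ i, T (i + 1) → f (2 * i + 1) = f (2 * i + 2) ∧ f (2 * i + 1) + 2 ≤ f (2 * i) ∧
    f (2 * i + 3) + 2 ≤ f (2 * i + 2)
  ev : ∀ i, g (2 * i) = evE (T i) (T (i + 1)) (f (2 * i)) (f (2 * i + 1))
  od : ∀ i, g (2 * i + 1) = odE (T i) (T (i + 1)) (f (2 * i)) (f (2 * i + 1))

theorem Shape.gap {f g : ℕ → ℕ} {T : ℕ → Prop} (h : Shape f g T) (i : ℕ)
    (hT : T i ∨ T (i + 1)) : f (2 * i + 1) + 2 ≤ f (2 * i) := by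
  rcases hT with hT | hT
  · cases i with
    | zero => exact absurd hT h.zero
    | succ i => exact (h.int i hT).2.2
  · exact (h.int i hT).2.1

theorem Shape.block {f g : ℕ → ℕ} {T : ℕ → Prop} (h : Shape f g T)
    (hdec : ∀ j, f (j + 1) ≤ f j) (hpar : ∀ i, f (2 * i) % 2 = f (2 * i + 1) % 2) (i : ℕ) :
    g (2 * i + 1) ≤ g (2 * i) ∧ g (2 * i) % 2 = g (2 * i + 1) % 2 := by
  have h1 := h.gap i
  have h2 := hdec (2 * i)
  have h3 := hpar i
  rw [h.ev, h.od]
  unfold evE odE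
  by_cases a : T i <;> by_cases b : T (i + 1) <;> simp only [a, b, true_or, or_true, true_and,
    false_and, if_true, if_false, forall_const] at * <;> (try split_ifs) <;> omega

theorem Shape.link {f g : ℕ → ℕ} {T : ℕ → Prop} (h : Shape f g T)
    (hdec : ∀ j, f (j + 1) ≤ f j) (i : ℕ) :
    g (2 * i + 2) ≤ g (2 * i + 1) ∧
    (g (2 * i + 1) = g (2 * i + 2) → ¬ T (i + 1) ∧ f (2 * i + 1) = f (2 * i + 2)) := by
  have h0 := h.int i
  have h2 := hdec (2 * i + 1)
  have e := h.ev (i + 1)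
  rw [show 2 * (i + 1) = 2 * i + 2 by ring] at e
  rw [e, h.od]
  unfold evE odE
  by_cases b : T (i + 1)
  · simp only [b, if_true, forall_const, not_true, false_and, imp_false] at *
    split_ifs <;> omega
  · simp only [b, if_false, not_false_iff, true_and, false_and] at *
    exact ⟨h2, id⟩

theorem Shape.dec {f g : ℕ → ℕ} {T : ℕ → Prop} (h : Shape f g T)
    (hdec : ∀ j, f (j + 1) ≤ f j) (hpar : ∀ i, f (2 * i) % 2 = f (2 * i + 1) % 2) (j : ℕ) :
    g (j + 1) ≤ g j := by
  rcases Nat.even_or_odd' j with ⟨k, rfl | rfl⟩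
  · exact (h.block hdec hpar k).1
  · exact (h.link hdec k).1

theorem Shape.step {f g : ℕ → ℕ} {T : ℕ → Prop} (h : Shape f g T)
    (i : ℕ) (hT : ¬ T (i + 1))
    (hint : f (2 * i + 1) = f (2 * i + 2) ∧ f (2 * i + 1) + 2 ≤ f (2 * i) ∧
      f (2 * i + 3) + 2 ≤ f (2 * i + 2)) (q : ℕ × ℕ × ℕ × ℕ)
    (hq : q = fundDeg (g (2 * i)) (g (2 * i + 1)) (g (2 * i + 2)) (g (2 * i + 3))) :
    Shape f (upd g i q) (fun j => T j ∨ j = i + 1) ∧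
    q.1 + q.2.1 + q.2.2.1 + q.2.2.2 =
      g (2 * i) + g (2 * i + 1) + g (2 * i + 2) + g (2 * i + 3) := by
  have e0 := h.ev i
  have e1 := h.od i
  have e2 := h.ev (i + 1)
  have e3 := h.od (i + 1)
  rw [show 2 * (i + 1) = 2 * i + 2 by ring] at e2 e3
  rw [show 2 * i + 2 + 1 = 2 * i + 3 by ring] at e2 e3
  obtain ⟨i1, i2, i3⟩ := hint
  have key : q.1 = evE (T i) True (f (2 * i)) (f (2 * i + 1)) ∧
      q.2.1 = odE (T i) True (f (2 * i)) (f (2 * i + 1)) ∧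
      q.2.2.1 = evE True (T (i + 1 + 1)) (f (2 * i + 2)) (f (2 * i + 3)) ∧
      q.2.2.2 = odE True (T (i + 1 + 1)) (f (2 * i + 2)) (f (2 * i + 3)) ∧
      q.1 + q.2.1 + q.2.2.1 + q.2.2.2 =
        g (2 * i) + g (2 * i + 1) + g (2 * i + 2) + g (2 * i + 3) := by
    subst hq
    unfold evE odE at *
    unfold fundDeg
    by_cases a : T i <;> by_cases b : T (i + 1 + 1) <;>
      simp only [a, b, hT, if_true, if_false, true_and, false_and] at * <;>
      rw [e0, e1, e2, e3] <;> split_ifs <;> refine ⟨?_, ?_, ?_, ?_, ?_⟩ <;> dsimp only <;> omega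
  obtain ⟨k0, k1, k2, k3, k4⟩ := key
  refine ⟨⟨?_, ?_, ?_, ?_⟩, k4⟩
  · rintro (h0 | h0)
    · exact h.zero h0
    · omega
  · rintro j (hj | hj)
    · exact h.int j hj
    · obtain rfl : j = i := by omega
      exact ⟨i1, i2, i3⟩
  · intro j
    by_cases hj : j = i
    · subst hj
      simpa [upd] using k0
    by_cases hj' : j = i + 1
    · subst hj'
      rw [show 2 * (i + 1) = 2 * i + 2 by ring]
      simpa [upd] using k2
    have a1 : ¬ (j + 1 = i + 1) := by omega
    simp only [hj', a1, or_false]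
    rw [← h.ev]
    unfold upd
    rw [if_neg (by omega), if_neg (by omega), if_neg (by omega), if_neg (by omega)]
  · intro j
    by_cases hj : j = i
    · subst hj
      simpa [upd] using k1
    by_cases hj' : j = i + 1
    · subst hj'
      rw [show 2 * (i + 1) = 2 * i + 2 by ring]
      rw [show 2 * i + 2 + 1 = 2 * i + 3 by ring]
      simpa [upd] using k3
    have a1 : ¬ (j + 1 = i + 1) := by omega
    simp only [hj', a1, or_false]
    rw [← h.od]
    unfold upd
    rw [if_neg (by omega), if_neg (by omega), if_neg (by omega), if_neg (by omega)]

/-- for a generic type C column sequence `O`, every member of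
`Norm(O)` is again a type C column sequence with the same total sum; in
particular every fundamental degeneration performed in the construction is
legitimate (the relevant quadruple has entries of the same parity, and the
entries that get lowered are large enough). -/
theorem normMem_typeC (O : List ℕ) (hO : TypeC O) (hg : GenericSeq O) :
    ∀ O', NormMem O O' → TypeC O' ∧ O'.sum = O.sum ∧
      ∀ i, 2 * i + 3 < O'.length → O'.getD (2 * i + 1) 0 = O'.getD (2 * i + 2) 0 →
        (O'.getD (2 * i + 2) 0 = O'.getD (2 * i + 3) 0 → 1 ≤ O'.getD (2 * i + 2) 0) ∧
        (O'.getD (2 * i + 3) 0 < O'.getD (2 * i + 2) 0 → 2 ≤ O'.getD (2 * i + 2) 0) ∧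
        O'.getD (2 * i) 0 % 2 = O'.getD (2 * i + 1) 0 % 2 ∧
        O'.getD (2 * i + 2) 0 % 2 = O'.getD (2 * i + 3) 0 % 2 := by
  have hdec := (dec_iff O).1 hO.2.1
  have hpar : ∀ i, O.getD (2 * i) 0 % 2 = O.getD (2 * i + 1) 0 % 2 := by
    intro i
    by_cases hi : 2 * i + 1 < O.length
    · have := Nat.even_iff.1 (hO.2.2 i hi)
      omega
    · have := Nat.even_iff.1 hO.1
      rw [List.getD_eq_default _ _ (by omega), List.getD_eq_default _ _ (by omega)]
  have hint : ∀ i, 2 * i + 3 < O.length → O.getD (2 * i + 1) 0 = O.getD (2 * i + 2) 0 →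
      O.getD (2 * i + 1) 0 = O.getD (2 * i + 2) 0 ∧
      O.getD (2 * i + 1) 0 + 2 ≤ O.getD (2 * i) 0 ∧
      O.getD (2 * i + 3) 0 + 2 ≤ O.getD (2 * i + 2) 0 := by
    intro i hi he
    have := strict_of_chains O (fun D hD => (hg D hD).imp (fun h => h.1) (fun h => h.2)) i hi he
    have p0 := hpar i
    have p1 := hpar (i + 1)
    rw [show 2 * (i + 1) = 2 * i + 2 by ring, show 2 * i + 2 + 1 = 2 * i + 3 by ring] at p1
    refine ⟨he, ?_, ?_⟩ <;> omega
  have inv : ∀ c, NormMem O c → (∃ T, Shape (fun j => O.getD j 0) (fun j => c.getD j 0) T) ∧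
      Even c.length ∧ c.length ≤ O.length ∧ c.sum = O.sum := by
    intro c hc
    induction hc with
    | base =>
      refine ⟨⟨fun _ => False, ⟨id, fun _ h => h.elim, ?_, ?_⟩⟩, hO.1, le_rfl, rfl⟩
      · intro i; simp [evE]
      · intro i; simp [odE]
    | step c i hc hi he ih =>
      obtain ⟨⟨T, hT⟩, hev, hle, hsum⟩ := ih
      have hl := (hT.link hdec i).2 he
      obtain ⟨hS, hs⟩ := hT.step i hl.1 (hint i (by omega) hl.2) _ rfl
      obtain ⟨d1, d2, d3⟩ := degenAt_spec c i hi hev _ rfl (hS.dec hdec hpar) hs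
      refine ⟨⟨fun j => T j ∨ j = i + 1, ?_⟩, d2, ?_, d3.trans hsum⟩
      · rw [← funext d1] at hS
        exact hS
      · refine le_trans ?_ hle
        unfold degenAt
        dsimp only
        split_ifs <;> simp <;> omega
  intro c hc
  obtain ⟨⟨T, hT⟩, hev, hle, hsum⟩ := inv c hc
  refine ⟨⟨hev, (dec_iff c).2 (hT.dec hdec hpar), ?_⟩, hsum, ?_⟩
  · intro i _
    have := (hT.block hdec hpar i).2
    rw [Nat.even_iff]
    omega
  · intro i hi he
    have hl := (hT.link hdec i).2 he
    have h3 := hint i (by omega) hl.2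
    have b0 := (hT.block hdec hpar i).2
    have b1 := (hT.block hdec hpar (i + 1)).2
    have e := hT.ev (i + 1)
    simp only [evE, hl.1, if_false] at e
    rw [show 2 * (i + 1) = 2 * i + 2 by ring] at b1 e
    rw [show 2 * i + 2 + 1 = 2 * i + 3 by ring] at b1
    refine ⟨?_, ?_, b0, b1⟩ <;> intro _ <;> omega
end

section
/- Let O be a generic type C column sequence with first (largest) entry c_0. Then every O' ∈ Norm(O) has the same first entry c_0; that is, the largest column is unchanged throughout the Norm construction. -/
def WGen (b : List ℕ) : Prop :=
  b.length = 2 ∨ ∀ i, 2 * i + 1 < b.length → b.getD (2 * i + 1) 0 < b.getD (2 * i) 0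

theorem chains_cons (x y : ℕ) (r : List ℕ) :
    ∃ C' L, chains (x :: y :: r) = (x :: y :: C') :: L := by
  rw [chains]
  split
  · exact ⟨[], [], rfl⟩
  · split
    · exact ⟨[], _, rfl⟩
    · exact ⟨_, _, rfl⟩

theorem wgen_pairs : ∀ (n : ℕ) (c : List ℕ), c.length ≤ n → (∀ C ∈ chains c, WGen C) →
    ∀ i, 2 * i + 3 < c.length → c.getD (2 * i + 1) 0 = c.getD (2 * i + 2) 0 →
      c.getD (2 * i + 1) 0 < c.getD (2 * i) 0 ∧ c.getD (2 * i + 3) 0 < c.getD (2 * i + 2) 0 := by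
  intro n
  induction n with
  | zero => intro c hc _ i hi; omega
  | succ n ih =>
    intro c hc hg i hi he
    match c, hc, hg, hi, he with
    | [], _, _, hi, _ => simp at hi
    | [_], _, _, hi, _ => simp at hi
    | [_, _], _, _, hi, _ => simp at hi
    | [_, _, _], _, _, hi, _ => simp at hi
    | a :: b :: x :: y :: r, hc, hg, hi, he =>
      obtain ⟨C', L, hC⟩ := chains_cons x y r
      rw [chains, hC] at hg
      simp only [List.headI_cons] at hg
      cases i with
      | zero =>
        simp at he
        subst he
        simp only [lt_irrefl, if_false] at hg
        have h1 := hg _ (List.mem_cons_self)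
        rcases h1 with h1 | h1
        · simp at h1
        · have h2 := h1 0 (by simp)
          have h3 := h1 1 (by simp)
          simp at h2 h3
          simp [h2, h3]
      | succ j =>
        have key := ih (x :: y :: r) (by simp at hc ⊢; omega) ?_ j (by simp at hi ⊢; omega)
          (by simpa [Nat.mul_add] using he)
        · simpa [Nat.mul_add] using key
        · rw [hC]
          intro D hD
          by_cases hxb : x < b <;> simp only [hxb, if_true, if_false] at hg
          · exact hg D (List.mem_cons_of_mem _ hD)
          · rcases List.mem_cons.1 hD with rfl | hD
            · right
              have h1 := hg _ (List.mem_cons_self)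
              rcases h1 with h1 | h1
              · simp at h1
              · intro k hk
                have := h1 (k + 1) (by simp at hk ⊢; omega)
                simpa [Nat.mul_add] using this
            · exact hg D (List.mem_cons_of_mem _ hD)

def PInv (O c : List ℕ) : Prop :=
  c.length ≤ O.length ∧ c.getD 0 0 = O.getD 0 0 ∧
  ∀ j, (c.getD (2 * j + 1) 0 = O.getD (2 * j + 1) 0 ∧ c.getD (2 * j + 2) 0 = O.getD (2 * j + 2) 0) ∨
    (O.getD (2 * j + 1) 0 = O.getD (2 * j + 2) 0 ∧ O.getD (2 * j + 1) 0 < c.getD (2 * j + 1) 0 ∧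
      c.getD (2 * j + 2) 0 < O.getD (2 * j + 2) 0)

theorem getD_repl (c : List ℕ) (m : ℕ) (h : m + 3 < c.length) (p q r s k : ℕ) :
    (c.take m ++ [p, q, r, s] ++ c.drop (m + 4)).getD k 0 =
      if k = m then p else if k = m + 1 then q else if k = m + 2 then r else
        if k = m + 3 then s else c.getD k 0 := by
  have hm : (c.take m).length = m := by simp; omega
  rcases lt_or_ge k m with hk | hk
  · rw [if_neg (by omega), if_neg (by omega), if_neg (by omega), if_neg (by omega)]
    rw [List.append_assoc, List.getD_append _ _ _ _ (by omega)]
    simp [List.getD_eq_getElem?_getD, List.getElem?_take, hk]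
  · obtain ⟨d, rfl⟩ := Nat.exists_eq_add_of_le hk
    rw [List.append_assoc, List.getD_append_right _ _ _ _ (by omega), hm]
    match d with
    | 0 => simp
    | 1 => simp
    | 2 => simp
    | 3 => simp
    | d + 4 =>
      simp [List.getD_eq_getElem?_getD]
      congr 2
      omega

theorem getD_degen (c : List ℕ) (i : ℕ) (h : 2 * i + 3 < c.length) (p q r s : ℕ)
    (hf : fundDeg (c.getD (2 * i) 0) (c.getD (2 * i + 1) 0)
      (c.getD (2 * i + 2) 0) (c.getD (2 * i + 3) 0) = (p, q, r, s))
    (hz : r = 0 → s = 0 → c.length = 2 * i + 4) :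
    (degenAt c i).length ≤ c.length ∧ ∀ k, (degenAt c i).getD k 0 =
      if k = 2 * i then p else if k = 2 * i + 1 then q else if k = 2 * i + 2 then r else
        if k = 2 * i + 3 then s else c.getD k 0 := by
  unfold degenAt
  rw [hf]
  simp only
  split
  · rename_i h0
    obtain ⟨rfl, rfl⟩ := h0
    have hl := hz rfl rfl
    refine ⟨by simp; omega, fun k => ?_⟩
    rw [← getD_repl c (2 * i) h]
    have hd : c.drop (2 * i + 4) = [] := by simp; omega
    have e : (c.take (2 * i) ++ [p, q, 0, 0] ++ c.drop (2 * i + 4)) =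
      (c.take (2 * i) ++ [p, q]) ++ [0] ++ [0] := by rw [hd]; simp
    rw [e, List.dropLast_concat, List.dropLast_concat]
    generalize c.take (2 * i) ++ [p, q] = l
    rcases lt_or_ge k l.length with hk | hk
    · rw [List.append_assoc, List.getD_append _ _ _ _ hk]
    · rw [List.append_assoc, List.getD_append_right _ _ _ _ hk, List.getD_eq_default _ _ hk]
      match k - l.length with
      | 0 => simp
      | 1 => simp
      | d + 2 => simp
  · exact ⟨by simp; omega, getD_repl c (2 * i) h p q r s⟩

set_option maxHeartbeats 2000000 in
theorem pinv_step (O c : List ℕ) (hO : TypeC O) (hg : GenericSeq O) (hc : PInv O c) (i : ℕ)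
    (h : 2 * i + 3 < c.length) (he : c.getD (2 * i + 1) 0 = c.getD (2 * i + 2) 0) :
    PInv O (degenAt c i) := by
  obtain ⟨hl, h0, hP⟩ := hc
  obtain ⟨hev, hmono, hpar⟩ := hO
  have hG := wgen_pairs _ O le_rfl (fun C hC => (hg C hC).imp (fun h => h.1) (fun h => h.2))
  have hi : c.getD (2 * i + 1) 0 = O.getD (2 * i + 1) 0 ∧
      c.getD (2 * i + 2) 0 = O.getD (2 * i + 2) 0 := by
    rcases hP i with h1 | h1
    · exact h1
    · omega
  obtain ⟨g1, g2⟩ := hG i (by omega) (by omega)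
  have p1 := hpar i (by omega)
  have p2 := hpar (i + 1) (by omega)
  rw [show 2 * (i + 1) + 1 = 2 * i + 3 by ring, show 2 * (i + 1) = 2 * i + 2 by ring] at p2
  rw [Nat.even_iff] at p1 p2
  have hn := hP (i + 1)
  rw [show 2 * (i + 1) + 1 = 2 * i + 3 by ring, show 2 * (i + 1) + 2 = 2 * i + 4 by ring] at hn
  -- what happens at the left end
  have hleft : c.getD (2 * i) 0 = c.getD (2 * i + 1) 0 → 0 < i ∧
      c.getD (2 * i) 0 + 1 < O.getD (2 * i) 0 := by
    intro h1
    refine ⟨?_, by omega⟩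
    rcases Nat.eq_zero_or_pos i with rfl | h2
    · simp only [Nat.mul_zero] at *; omega
    · exact h2
  have hz0 : O.getD (2 * i + 3) 0 = 0 → c.length = 2 * i + 4 := by
    intro h1
    by_contra h2
    have h3 : 2 * i + 5 < O.length := by
      rw [Nat.even_iff] at hev; omega
    have h4 : O.getD (2 * i + 4) 0 ≤ O.getD (2 * i + 3) 0 := by
      have := List.isChain_iff_getElem.1 hmono (2 * i + 3) (by omega)
      rw [List.getD_eq_getElem _ _ (by omega), List.getD_eq_getElem _ _ (by omega)]
      exact this
    have := hG (i + 1) (by omega)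
    rw [show 2 * (i + 1) + 1 = 2 * i + 3 by ring, show 2 * (i + 1) + 2 = 2 * i + 4 by ring] at this
    have := (this (by omega)).2
    omega
  obtain ⟨p, q, r, s, hf, hp, hq, hr, hs⟩ : ∃ p q r s,
      fundDeg (c.getD (2 * i) 0) (c.getD (2 * i + 1) 0)
        (c.getD (2 * i + 2) 0) (c.getD (2 * i + 3) 0) = (p, q, r, s) ∧
      (p = c.getD (2 * i) 0 ∨ p = c.getD (2 * i) 0 + 1 ∧
        c.getD (2 * i) 0 = c.getD (2 * i + 1) 0) ∧
      c.getD (2 * i + 1) 0 < q ∧ r < c.getD (2 * i + 2) 0 ∧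
      (s = c.getD (2 * i + 3) 0 ∨ s = c.getD (2 * i + 3) 0 - 1 ∧
        c.getD (2 * i + 2) 0 = c.getD (2 * i + 3) 0) := by
    unfold fundDeg
    split <;> split <;> exact ⟨_, _, _, _, rfl, by omega, by omega, by omega, by omega⟩
  obtain ⟨hlen, hget⟩ := getD_degen c i h p q r s hf (by
    intro hr0 hs0
    apply hz0
    omega)
  refine ⟨by omega, ?_, ?_⟩
  · rw [hget]
    rcases Nat.eq_zero_or_pos i with rfl | h2
    · simp only [Nat.mul_zero] at *
      simp only [if_true]; omega
    · rw [if_neg (by omega), if_neg (by omega), if_neg (by omega), if_neg (by omega)]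
      exact h0
  · intro j
    rw [hget, hget]
    have hj := hP j
    rcases lt_trichotomy j i with hji | rfl | hji
    · rw [if_neg (by omega), if_neg (by omega), if_neg (by omega), if_neg (by omega)]
      by_cases h3 : j + 1 = i
      · subst h3
        rw [show 2 * (j + 1) = 2 * j + 2 by ring] at *
        simp only [if_true]
        clear hget hG hP hpar hn hf hz0 hq hr hs
        rcases hp with hp | ⟨hp, hp'⟩
        · rw [hp]; exact hj
        · have := (hleft hp').2
          clear hleft
          omega
      · rw [if_neg (by omega), if_neg (by omega), if_neg (by omega), if_neg (by omega)]
        exact hj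
    · simp
      simp only [List.getD_eq_getElem?_getD] at *
      omega
    · by_cases h3 : j = i + 1
      · subst h3
        rw [show 2 * (i + 1) + 1 = 2 * i + 3 by ring, show 2 * (i + 1) + 2 = 2 * i + 4 by ring] at *
        simp
        simp only [List.getD_eq_getElem?_getD] at *
        omega
      · rw [if_neg (by omega), if_neg (by omega), if_neg (by omega), if_neg (by omega),
          if_neg (by omega), if_neg (by omega), if_neg (by omega), if_neg (by omega)]
        exact hj

/-- for a generic type C column sequence, every member of
`Norm(O)` has the same first (largest) entry as `O`. -/
theorem normMem_head_eq (O : List ℕ) (hO : TypeC O) (hg : GenericSeq O) :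
    ∀ O', NormMem O O' → O'.headI = O.headI := by
  intro O' h
  have key : PInv O O' := by
    induction h with
    | base => exact ⟨le_rfl, rfl, fun j => Or.inl ⟨rfl, rfl⟩⟩
    | step c i _ h1 h2 ih => exact pinv_step O c hO hg ih i h1 h2
  have e : ∀ l : List ℕ, l.headI = l.getD 0 0 := by
    intro l; cases l <;> simp
  rw [e, e]
  exact key.2.1
end

section
/- Let O be a generic type C column sequence. Then Norm(O) contains a unique element O_λ all of whose chains have length 2, and Norm(O) equals the set of all type C column sequences O' with the same total sum as O satisfying Σ_{i≤j} (O_λ)_i ≥ Σ_{i≤j} O'_i ≥ Σ_{i≤j} O_i for every j (after padding with zeros to a common length); that is, Norm(O) consists precisely of the column sequences of the nilpotent orbits lying between the closure of the orbit of O_λ and the closure of the orbit of O. -/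
namespace NI

theorem psum (c : List ℕ) (j : ℕ) : (c.take (j+1)).sum = (c.take j).sum + c.getD j 0 := by
  induction c generalizing j with
  | nil => simp
  | cons a t ih =>
    cases j with
    | zero => simp
    | succ j => simp only [List.take_succ_cons, List.sum_cons, ih, List.getD_cons_succ]; omega

theorem chains_cons (c d : ℕ) (r : List ℕ) : ∃ T L, chains (c :: d :: r) = (c :: d :: T) :: L := by
  rw [chains]
  rcases chains r with _ | ⟨C, L⟩
  · exact ⟨[], [], rfl⟩
  · simp only
    split_ifs
    · exact ⟨_, _, rfl⟩
    · exact ⟨_, _, rfl⟩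

def W (C : List ℕ) : Prop :=
  4 ≤ C.length → ∀ i, 2 * i + 1 < C.length → C.getD (2 * i + 1) 0 < C.getD (2 * i) 0

theorem genW : ∀ c : List ℕ, (∀ C ∈ chains c, W C) → ∀ i, 2 * i + 3 < c.length →
    c.getD (2 * i + 1) 0 = c.getD (2 * i + 2) 0 →
    c.getD (2 * i + 1) 0 < c.getD (2 * i) 0 ∧ c.getD (2 * i + 3) 0 < c.getD (2 * i + 2) 0
  | [], _, i, hi, _ => by simp at hi
  | [a], _, i, hi, _ => by simp at hi
  | [a, b], _, i, hi, _ => by simp at hi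
  | [a, b, x], _, i, hi, _ => by simp at hi
  | a :: b :: c :: d :: r, h, i, hi, he => by
    obtain ⟨T, L, hT⟩ := chains_cons c d r
    rw [chains, hT] at h
    change ∀ C ∈ (if c < b then [a, b] :: (c :: d :: T) :: L else (a :: b :: c :: d :: T) :: L),
      W C at h
    have hrec : ∀ C ∈ chains (c :: d :: r), W C := by
      rw [hT]
      intro C hC
      by_cases hb : c < b
      · rw [if_pos hb] at h
        exact h C (List.mem_cons_of_mem _ hC)
      · rw [if_neg hb] at h
        rcases List.mem_cons.1 hC with rfl | hC
        · have h0 := h _ (List.mem_cons_self ..)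
          intro hl k hk
          have := h0 (by simp) (k+1) (by simp at hk ⊢; omega)
          simpa [Nat.mul_add] using this
        · exact h C (List.mem_cons_of_mem _ hC)
    cases i with
    | zero =>
      simp at he
      subst he
      simp only [lt_irrefl, if_false] at h
      have h0 := h _ (List.mem_cons_self ..)
      have h1 := h0 (by simp) 0 (by simp)
      have h2 := h0 (by simp) 1 (by simp)
      simpa using ⟨h1, h2⟩
    | succ i =>
      have := genW (c :: d :: r) hrec i (by simp at hi ⊢; omega) (by simpa [Nat.mul_add] using he)
      simpa [Nat.mul_add] using this

theorem len2 : ∀ c : List ℕ, (∀ C ∈ chains c, C.length = 2) ↔ ∀ i, 2 * i + 3 < c.length →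
    c.getD (2 * i + 2) 0 < c.getD (2 * i + 1) 0
  | [] => by simp [chains]
  | [a] => by simp [chains]
  | [a, b] => by simp [chains]
  | [a, b, x] => by simp [chains]
  | a :: b :: c :: d :: r => by
    obtain ⟨T, L, hT⟩ := chains_cons c d r
    have ih := len2 (c :: d :: r)
    have key : (∀ C ∈ chains (a :: b :: c :: d :: r), C.length = 2) ↔
        c < b ∧ ∀ C ∈ chains (c :: d :: r), C.length = 2 := by
      rw [chains, hT]
      simp only [List.headI]
      split_ifs with hb
      · simp [hb]
      · simp [hb]
    rw [key, ih]
    constructor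
    · rintro ⟨h1, h2⟩ i hi
      cases i with
      | zero => simpa using h1
      | succ i =>
        have := h2 i (by simp at hi ⊢; omega)
        simpa [Nat.mul_add] using this
    · intro h
      refine ⟨by simpa using h 0 (by simp), fun i hi => ?_⟩
      have := h (i+1) (by simp at hi ⊢; omega)
      simpa [Nat.mul_add] using this

structure Dat (f : ℕ → ℕ) (n : ℕ) (I : Finset ℕ) : Prop where
  anti : ∀ j, f (j+1) ≤ f j
  par : ∀ i, (f (2*i) + f (2*i+1)) % 2 = 0
  ne : n % 2 = 0
  zero : ∀ j, n ≤ j → f j = 0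
  mem : ∀ i, i ∈ I ↔ 2*i+3 < n ∧ f (2*i+1) = f (2*i+2)
  gen : ∀ i ∈ I, f (2*i+1) + 2 ≤ f (2*i) ∧ f (2*i+3) + 2 ≤ f (2*i+2)

def pr (S : Finset ℕ) (i : ℕ) : Prop := ∃ k ∈ S, k + 1 = i

open Classical in
noncomputable def vx (f : ℕ → ℕ) (S : Finset ℕ) (i : ℕ) : ℕ :=
  if pr S i then (if i ∈ S ∧ f (2*i) = f (2*i+1) + 2 then f (2*i) - 1 else f (2*i) - 2) else f (2*i)

open Classical in
noncomputable def vy (f : ℕ → ℕ) (S : Finset ℕ) (i : ℕ) : ℕ :=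
  if i ∈ S then (if pr S i ∧ f (2*i) = f (2*i+1) + 2 then f (2*i+1) + 1 else f (2*i+1) + 2)
  else f (2*i+1)

open Classical in
noncomputable def dx (S : Finset ℕ) (i : ℕ) : ℕ := if pr S i then 2 else 0

open Classical in
noncomputable def dy (f : ℕ → ℕ) (S : Finset ℕ) (i : ℕ) : ℕ :=
  if pr S i ∧ i ∈ S ∧ f (2*i) = f (2*i+1) + 2 then 1 else 0

def del (f : ℕ → ℕ) (n : ℕ) (S : Finset ℕ) : Prop :=
  ∃ i ∈ S, 2*i+4 = n ∧ f (2*i+2) = 2 ∧ f (2*i+3) = 0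

structure Rep (f : ℕ → ℕ) (n : ℕ) (S : Finset ℕ) (c : List ℕ) : Prop where
  len1 : del f n S → c.length + 2 = n
  len0 : ¬ del f n S → c.length = n
  ex : ∀ i, c.getD (2*i) 0 = vx f S i
  ey : ∀ i, c.getD (2*i+1) 0 = vy f S i

theorem pr_succ (S : Finset ℕ) (i : ℕ) : pr S (i+1) ↔ i ∈ S := by simp [pr]
theorem pr_zero (S : Finset ℕ) : ¬ pr S 0 := by simp [pr]

theorem list_ext (c d : List ℕ) (h : c.length = d.length) (he : ∀ j, c.getD j 0 = d.getD j 0) :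
    c = d := by
  apply List.ext_getElem h
  intro i h1 h2
  have := he i
  simpa [List.getD_eq_getElem, h1, h2] using this

theorem Rep.get_eq {f n S c d} (h : Rep f n S c) (h' : Rep f n S d) : c = d := by
  apply list_ext
  · by_cases hd : del f n S
    · have := h.len1 hd; have := h'.len1 hd; omega
    · rw [h.len0 hd, h'.len0 hd]
  · intro j
    rcases Nat.even_or_odd' j with ⟨i, rfl | rfl⟩
    · rw [h.ex, h'.ex]
    · rw [h.ey, h'.ey]

theorem Dat.pr_gen {f n I S} (D : Dat f n I) (hS : S ⊆ I) {i} (h : pr S i) :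
    f (2*i+1) + 2 ≤ f (2*i) := by
  obtain ⟨k, hk, rfl⟩ := h
  exact (D.gen k (hS hk)).2

theorem degen_get (c : List ℕ) (i : ℕ) (q0 q1 q2 q3 : ℕ)
    (hq : fundDeg (c.getD (2 * i) 0) (c.getD (2 * i + 1) 0)
      (c.getD (2 * i + 2) 0) (c.getD (2 * i + 3) 0) = (q0, q1, q2, q3))
    (hl : 2*i+3 < c.length) (hd : q2 = 0 ∧ q3 = 0 → 2*i+4 = c.length) :
    (q2 = 0 ∧ q3 = 0 → (degenAt c i).length + 2 = c.length) ∧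
    (¬ (q2 = 0 ∧ q3 = 0) → (degenAt c i).length = c.length) ∧
    (degenAt c i).getD (2*i) 0 = q0 ∧ (degenAt c i).getD (2*i+1) 0 = q1 ∧
    (degenAt c i).getD (2*i+2) 0 = q2 ∧ (degenAt c i).getD (2*i+3) 0 = q3 ∧
    ∀ j, (j < 2*i ∨ 2*i+3 < j) → (degenAt c i).getD j 0 = c.getD j 0 := by
  have hg : ∀ j, (c.take (2 * i) ++ [q0, q1, q2, q3] ++ c.drop (2 * i + 4)).getD j 0 =
      if j = 2*i then q0 else if j = 2*i+1 then q1 else if j = 2*i+2 then q2 else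
      if j = 2*i+3 then q3 else c.getD j 0 := by
    intro j
    have h1 : (c.take (2*i)).length = 2*i := by simp; omega
    simp only [List.getD_eq_getElem?_getD, List.append_assoc]
    rcases lt_or_ge j (2*i) with h | h
    · rw [List.getElem?_append_left (by omega), List.getElem?_take_of_lt h]
      rw [if_neg, if_neg, if_neg, if_neg] <;> omega
    · rw [List.getElem?_append_right (by omega), h1]
      obtain ⟨k, rfl⟩ := Nat.exists_eq_add_of_le h
      rcases k with _ | _ | _ | _ | k
      · simp
      · simp
      · simp
      · simp
      · have e : 2 * i + (k+1+1+1+1) - 2*i = k+1+1+1+1 := by omega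
        rw [e, if_neg, if_neg, if_neg, if_neg] <;> try omega
        simp
        congr 2; omega
  have hL : (c.take (2 * i) ++ [q0, q1, q2, q3] ++ c.drop (2 * i + 4)).length = c.length := by
    simp; omega
  unfold degenAt
  simp only [hq]
  generalize (c.take (2 * i) ++ [q0, q1, q2, q3] ++ c.drop (2 * i + 4)) = c' at hg hL ⊢
  have hmain : ∀ j, (if q2 = 0 ∧ q3 = 0 then c'.dropLast.dropLast else c').getD j 0 =
      c'.getD j 0 := by
    intro j
    split_ifs with h
    · have h4 := hd h
      rcases lt_or_ge j (2*i+2) with hj | hj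
      · simp only [List.getD_eq_getElem?_getD, List.getElem?_dropLast, List.length_dropLast]
        rw [if_pos (by omega), if_pos (by omega)]
      · rw [List.getD_eq_default _ _ (by simp; omega)]
        rw [hg]
        split_ifs <;> try omega
        rw [List.getD_eq_default _ _ (by omega)]
    · rfl
  simp only [hmain, hg]
  refine ⟨?_, ?_, ?_, ?_, ?_, ?_, ?_⟩
  · intro h; rw [if_pos h]; simp; omega
  · intro h; rw [if_neg h]; exact hL
  · simp
  · simp
  · simp
  · simp
  · intro j hj
    rw [if_neg, if_neg, if_neg, if_neg] <;> omega

theorem Rep.mem_of_eq {f n I S c} (D : Dat f n I) (hS : S ⊆ I) (R : Rep f n S c) (i : ℕ)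
    (hl : 2*i+3 < c.length) (he : c.getD (2*i+1) 0 = c.getD (2*i+2) 0) : i ∈ I ∧ i ∉ S := by
  have hl' : 2*i+3 < n := by
    by_cases hd : del f n S
    · have := R.len1 hd; omega
    · rw [← R.len0 hd]; exact hl
  have e1 := R.ey i
  have e2 := R.ex (i+1)
  rw [show 2*(i+1) = 2*i+2 by ring, ← he, e1] at e2
  simp only [vx, vy, pr_succ, show 2*(i+1) = 2*i+2 by ring, Nat.add_assoc, Nat.reduceAdd] at e2
  have a1 : f (2*i+2) ≤ f (2*i+1) := D.anti (2*i+1)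
  have hni : i ∉ S := by
    intro hi
    have h1 := D.gen i (hS hi)
    rw [if_pos hi, if_pos hi] at e2
    split_ifs at e2 <;> omega
  refine ⟨?_, hni⟩
  rw [D.mem]
  rw [if_neg hni, if_neg hni] at e2
  exact ⟨hl', e2⟩

theorem Rep.ready {f n I S c} (R : Rep f n S c) (D : Dat f n I) (i : ℕ)
    (hi : i ∈ I) (hn : i ∉ S) : 2*i+3 < c.length ∧ c.getD (2*i+1) 0 = c.getD (2*i+2) 0 := by
  have h := (D.mem i).1 hi
  have hne := D.ne
  constructor
  · by_cases hd : del f n S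
    · have h1 := R.len1 hd
      obtain ⟨k, hk, h2, _⟩ := hd
      have : k ≠ i := by rintro rfl; exact hn hk
      omega
    · rw [R.len0 hd]; exact h.1
  · rw [R.ey i, show 2*i+2 = 2*(i+1) by ring, R.ex (i+1)]
    simp only [vx, vy, pr_succ, show 2*(i+1) = 2*i+2 by ring, Nat.add_assoc, Nat.reduceAdd, if_neg hn]
    exact h.2

theorem Rep.step {f n I S c} (D : Dat f n I) (hS : S ⊆ I) (R : Rep f n S c) (i : ℕ)
    (hi : i ∈ I) (hn : i ∉ S) : Rep f n (insert i S) (degenAt c i) := by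
  obtain ⟨hl, he⟩ := R.ready D i hi hn
  have hmi := (D.mem i).1 hi
  have hgi := D.gen i hi
  have hne := D.ne
  have hp1 : (f (2*i+2) + f (2*i+3)) % 2 = 0 := D.par (i+1)
  have b0 := R.ex i
  have b1 : c.getD (2*i+1) 0 = f (2*i+1) := by rw [R.ey i]; simp [vy, hn]
  have b2 : c.getD (2*i+2) 0 = f (2*i+2) := by rw [← he, b1]; exact hmi.2
  have b3 := R.ey (i+1)
  have hlast : f (2*i+3) = 0 → 2*i+4 = n ∧ i+1 ∉ I := by
    intro h0
    have : i+1 ∉ I := by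
      intro hI
      have := (D.gen _ hI).1
      have h3 := ((D.mem _).1 hI).2
      have h4 := (D.gen _ hI).2
      simp only [show 2*(i+1) = 2*i+2 by ring, Nat.add_assoc, Nat.reduceAdd] at *
      omega
    refine ⟨?_, this⟩
    by_contra hc
    apply this
    rw [D.mem]
    have : f (2*i+4) ≤ f (2*i+3) := D.anti (2*i+3)
    simp only [show 2*(i+1) = 2*i+2 by ring, Nat.add_assoc, Nat.reduceAdd] at *
    omega
  rw [show 2*(i+1)+1 = 2*i+3 by ring] at b3
  simp only [vx] at b0
  simp only [vy, pr_succ, hn, false_and, if_false, show 2*(i+1) = 2*i+2 by ring, Nat.add_assoc, Nat.reduceAdd] at b3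
  obtain ⟨⟨q0, q1, q2, q3⟩, hq⟩ : ∃ q, fundDeg (c.getD (2 * i) 0) (c.getD (2 * i + 1) 0)
      (c.getD (2 * i + 2) 0) (c.getD (2 * i + 3) 0) = q := ⟨_, rfl⟩
  have hq' := hq
  rw [b0, b1, b2, b3] at hq'
  simp only [hn, false_and, if_false] at hq'
  have hx : q0 = vx f (insert i S) i ∧ q1 = vy f (insert i S) i := by
    have hpr : pr (insert i S) i ↔ pr S i := by simp [pr]
    simp only [vx, vy, hpr, Finset.mem_insert, true_or, true_and, if_true]
    simp only [fundDeg] at hq'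
    split_ifs at hq' ⊢ <;> simp only [Prod.mk.injEq] at hq' <;> grind
  have hy : q2 = vx f (insert i S) (i+1) ∧ q3 = vy f (insert i S) (i+1) := by
    simp only [vx, vy, pr_succ, Finset.mem_insert, true_or, true_and, if_true,
      show 2*(i+1) = 2*i+2 by ring, Nat.add_assoc, Nat.reduceAdd, show ¬ (i+1 = i) by omega, false_or]
    simp only [fundDeg] at hq'
    split_ifs at hq' ⊢ <;> simp only [Prod.mk.injEq] at hq' <;> grind
  have hz : q2 = 0 ∧ q3 = 0 ↔ f (2*i+2) = 2 ∧ f (2*i+3) = 0 := by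
    have hSI : f (2*i+3) = 0 → i+1 ∉ S := fun h h' => (hlast h).2 (hS h')
    rw [hy.1, hy.2]
    simp only [vx, vy, pr_succ, Finset.mem_insert, true_or, true_and, if_true,
      show 2*(i+1) = 2*i+2 by ring, Nat.add_assoc, Nat.reduceAdd, show ¬ (i+1 = i) by omega, false_or]
    by_cases hs : i+1 ∈ S
    · have : f (2*i+3) ≠ 0 := fun h => hSI h hs
      simp only [hs, true_and, if_true]
      split_ifs <;> omega
    · simp only [hs, false_and, if_false]
      omega
  have hnd : 2*i+4 = n → ¬ del f n S := by
    rintro h ⟨k, hk, h2, _⟩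
    have : k = i := by omega
    exact hn (this ▸ hk)
  obtain ⟨g1, g2, g3, g4, g5, g6, g7⟩ := degen_get c i q0 q1 q2 q3 hq hl (by
    intro h
    have h4 := (hlast (hz.1 h).2).1
    rw [R.len0 (hnd h4), h4])
  have hother : ∀ k, k ≠ i → k ≠ i+1 → vx f (insert i S) k = vx f S k ∧
      vy f (insert i S) k = vy f S k := by
    intro k h1 h2
    have hpr : pr (insert i S) k ↔ pr S k := by
      simp only [pr, Finset.mem_insert]
      constructor
      · rintro ⟨m, rfl | hm, rfl⟩
        · omega
        · exact ⟨m, hm, rfl⟩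
      · rintro ⟨m, hm, rfl⟩
        exact ⟨m, Or.inr hm, rfl⟩
    by_cases hp : pr S k
    · have hp' := hpr.2 hp
      simp only [vx, vy, hp, hp', Finset.mem_insert, h1, false_or, and_self]
    · have hp' : ¬ pr (insert i S) k := fun h => hp (hpr.1 h)
      simp only [vx, vy, hp, hp', Finset.mem_insert, h1, false_or, and_self]
  have hdel : del f n (insert i S) ↔ (q2 = 0 ∧ q3 = 0) ∨ del f n S := by
    rw [hz]
    constructor
    · rintro ⟨k, hk, h1, h2, h3⟩
      rcases Finset.mem_insert.1 hk with rfl | hk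
      · exact Or.inl ⟨h2, h3⟩
      · exact Or.inr ⟨k, hk, h1, h2, h3⟩
    · rintro (⟨h1, h2⟩ | ⟨k, hk, h⟩)
      · exact ⟨i, Finset.mem_insert_self .., (hlast h2).1, h1, h2⟩
      · exact ⟨k, Finset.mem_insert_of_mem hk, h⟩
  refine ⟨?_, ?_, ?_, ?_⟩
  · intro h
    by_cases h0 : q2 = 0 ∧ q3 = 0
    · rw [g1 h0, R.len0 (hnd (hlast (hz.1 h0).2).1)]
    · rw [g2 h0]
      exact R.len1 ((hdel.1 h).resolve_left h0)
  · intro h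
    rw [hdel, not_or] at h
    rw [g2 h.1, R.len0 h.2]
  · intro k
    by_cases h1 : k = i
    · subst h1; rw [g3, hx.1]
    by_cases h2 : k = i+1
    · subst h2; rw [show 2*(i+1) = 2*i+2 by ring, g5, hy.1]
    rw [g7 _ (by omega), R.ex, (hother k h1 h2).1]
  · intro k
    by_cases h1 : k = i
    · subst h1; rw [g4, hx.2]
    by_cases h2 : k = i+1
    · subst h2; rw [show 2*(i+1)+1 = 2*i+3 by ring, g6, hy.2]
    rw [g7 _ (by omega), R.ey, (hother k h1 h2).2]

theorem Rep.sums {f n I S} {c O : List ℕ} (D : Dat f n I) (hS : S ⊆ I) (R : Rep f n S c)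
    (hf : ∀ j, O.getD j 0 = f j) (i : ℕ) :
    (c.take (2*i)).sum = (O.take (2*i)).sum + dx S i ∧
    (c.take (2*i+1)).sum = (O.take (2*i+1)).sum + dy f S i := by
  have key : ∀ i, (c.take (2*i)).sum = (O.take (2*i)).sum + dx S i →
      (c.take (2*i+1)).sum = (O.take (2*i+1)).sum + dy f S i := by
    intro i h
    rw [psum, psum, h, R.ex, hf]
    simp only [dx, dy, vx]
    by_cases hp : pr S i
    · have := D.pr_gen hS hp
      simp only [hp, if_true, true_and]
      split_ifs <;> omega
    · simp [hp]
  induction i with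
  | zero =>
    have : (c.take (2*0)).sum = (O.take (2*0)).sum + dx S 0 := by simp [dx, pr_zero]
    exact ⟨this, key 0 this⟩
  | succ i ih =>
    have : (c.take (2*(i+1))).sum = (O.take (2*(i+1))).sum + dx S (i+1) := by
      rw [show 2*(i+1) = 2*i+1+1 by ring, psum c (2*i+1), psum O (2*i+1), ih.2, R.ey, hf]
      simp only [dx, dy, vy, pr_succ]
      by_cases hi : i ∈ S
      · by_cases hc : pr S i ∧ f (2*i) = f (2*i+1) + 2
        · rw [if_pos hi, if_pos hi, if_pos hc, if_pos ⟨hc.1, hi, hc.2⟩]; omega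
        · rw [if_pos hi, if_pos hi, if_neg hc, if_neg (fun h => hc ⟨h.1, h.2.2⟩)]; omega
      · simp [hi]
    exact ⟨this, key _ this⟩

theorem Rep.typeC {f n I S} {c : List ℕ} (D : Dat f n I) (hS : S ⊆ I) (R : Rep f n S c) :
    TypeC c := by
  have hne := D.ne
  refine ⟨?_, ?_, ?_⟩
  · rw [Nat.even_iff]
    by_cases hd : del f n S
    · have := R.len1 hd; omega
    · rw [R.len0 hd]; exact hne
  · have hj : ∀ j, c.getD (j+1) 0 ≤ c.getD j 0 := by
      intro j
      rcases Nat.even_or_odd' j with ⟨i, rfl | rfl⟩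
      · rw [R.ey, R.ex]
        have h1 := D.anti (2*i)
        have hp := D.par i
        simp only [vx, vy]
        by_cases h2 : pr S i
        · have := D.pr_gen hS h2
          by_cases h3 : i ∈ S
          · simp only [h2, h3, if_true, true_and]; split_ifs <;> omega
          · simp only [h2, h3, if_true, false_and, if_false]; omega
        · by_cases h3 : i ∈ S
          · have := (D.gen i (hS h3)).1
            simp only [h2, h3, if_true, false_and, if_false]; omega
          · simp only [h2, h3, if_false]; omega
      · rw [show 2*i+1+1 = 2*(i+1) by ring, R.ey, R.ex]
        have h1 : f (2*i+2) ≤ f (2*i+1) := D.anti (2*i+1)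
        simp only [vx, vy, pr_succ, show 2*(i+1) = 2*i+2 by ring, Nat.add_assoc, Nat.reduceAdd]
        by_cases h3 : i ∈ S
        · simp only [h3, if_true]
          split_ifs <;> omega
        · simp only [h3, if_false]; omega
    refine List.isChain_iff_getElem.2 ?_
    intro j h
    have := hj j
    rw [List.getD_eq_getElem _ _ h, List.getD_eq_getElem _ _ (by omega)] at this
    exact this
  · intro i _
    rw [R.ex, R.ey, Nat.even_iff]
    have hp := D.par i
    simp only [vx, vy]
    by_cases h2 : pr S i
    · have := D.pr_gen hS h2
      by_cases h3 : i ∈ S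
      · simp only [h2, h3, if_true, true_and]; split_ifs <;> omega
      · simp only [h2, h3, if_true, false_and, if_false]; omega
    · by_cases h3 : i ∈ S
      · simp only [h2, h3, if_true, false_and, if_false]; omega
      · simp only [h2, h3, if_false]; omega

theorem typeC_anti {c : List ℕ} (h : TypeC c) (j : ℕ) : c.getD (j+1) 0 ≤ c.getD j 0 := by
  by_cases hj : j + 1 < c.length
  · have h2 := List.isChain_iff_getElem.1 h.2.1 j hj
    rw [List.getD_eq_getElem _ _ hj, List.getD_eq_getElem _ _ (by omega)]
    exact h2
  · rw [List.getD_eq_default _ _ (by omega)]; omega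

theorem typeC_par {c : List ℕ} (h : TypeC c) (i : ℕ) :
    (c.getD (2*i) 0 + c.getD (2*i+1) 0) % 2 = 0 := by
  by_cases hj : 2*i + 1 < c.length
  · exact Nat.even_iff.1 (h.2.2 i hj)
  · have := Nat.even_iff.1 h.1
    rw [List.getD_eq_default _ _ (by omega), List.getD_eq_default _ _ (by omega)]

theorem typeC_psum {c : List ℕ} (h : TypeC c) (i : ℕ) : (c.take (2*i)).sum % 2 = 0 := by
  induction i with
  | zero => simp
  | succ i ih =>
    rw [show 2*(i+1) = 2*i+1+1 by ring, psum, psum]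
    have := typeC_par h i
    omega

theorem dat {O : List ℕ} (hO : TypeC O) (hg : GenericSeq O) :
    Dat (fun j => O.getD j 0) O.length ((Finset.range O.length).filter
      fun i => 2*i+3 < O.length ∧ O.getD (2*i+1) 0 = O.getD (2*i+2) 0) where
  anti := typeC_anti hO
  par := typeC_par hO
  ne := Nat.even_iff.1 hO.1
  zero := fun j hj => List.getD_eq_default _ _ hj
  mem := by
    intro i
    simp only [Finset.mem_filter, Finset.mem_range]
    constructor
    · exact fun h => h.2
    · exact fun h => ⟨by omega, h⟩
  gen := by
    intro i hi
    simp only [Finset.mem_filter, Finset.mem_range] at hi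
    have h := genW O (by
      intro C hC h4
      rcases hg C hC with h | h
      · omega
      · exact h.2) i hi.2.1 hi.2.2
    have h1 := typeC_par hO i
    have h2 : (O.getD (2*i+2) 0 + O.getD (2*i+3) 0) % 2 = 0 := typeC_par hO (i+1)
    show O.getD _ 0 + 2 ≤ O.getD _ 0 ∧ O.getD _ 0 + 2 ≤ O.getD _ 0
    omega

theorem rep_empty (O : List ℕ) : Rep (fun j => O.getD j 0) O.length ∅ O where
  len1 := by rintro ⟨k, hk, _⟩; simp at hk
  len0 := fun _ => rfl
  ex := by intro i; simp [vx, pr]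
  ey := by intro i; simp [vy]

theorem norm_rep {O : List ℕ} {I} (D : Dat (fun j => O.getD j 0) O.length I) {c : List ℕ}
    (h : NormMem O c) : ∃ S ⊆ I, Rep (fun j => O.getD j 0) O.length S c := by
  induction h with
  | base => exact ⟨∅, by simp, rep_empty O⟩
  | step c i _ hl he ih =>
    obtain ⟨S, hS, R⟩ := ih
    obtain ⟨h1, h2⟩ := R.mem_of_eq D hS i hl he
    exact ⟨insert i S, Finset.insert_subset h1 hS, R.step D hS i h1 h2⟩

theorem rep_norm {O : List ℕ} {I} (D : Dat (fun j => O.getD j 0) O.length I) (S : Finset ℕ)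
    (hS : S ⊆ I) : ∃ c, NormMem O c ∧ Rep (fun j => O.getD j 0) O.length S c := by
  induction S using Finset.induction_on with
  | empty => exact ⟨O, .base, rep_empty O⟩
  | insert i S hi ih =>
    obtain ⟨c, hc, R⟩ := ih ((Finset.subset_insert ..).trans hS)
    have hI := hS (Finset.mem_insert_self i S)
    obtain ⟨hl, he⟩ := R.ready D i hI hi
    exact ⟨_, .step c i hc hl he, R.step D ((Finset.subset_insert ..).trans hS) i hI hi⟩

theorem between {O O' : List ℕ} {I} (D : Dat (fun j => O.getD j 0) O.length I)
    (hO : TypeC O) (h : TypeC O')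
    (hx : ∀ i, (O.take (2*i)).sum ≤ (O'.take (2*i)).sum ∧
      (O'.take (2*i)).sum ≤ (O.take (2*i)).sum + dx I i)
    (hy : ∀ i, (O.take (2*i+1)).sum ≤ (O'.take (2*i+1)).sum ∧
      (O'.take (2*i+1)).sum ≤ (O.take (2*i+1)).sum + dy (fun j => O.getD j 0) I i) :
    ∃ S ⊆ I, ∀ i, (O'.take (2*i)).sum = (O.take (2*i)).sum + dx S i ∧
      (O'.take (2*i+1)).sum = (O.take (2*i+1)).sum + dy (fun j => O.getD j 0) S i := by
  classical
  set S := I.filter fun i => (O'.take (2*i+2)).sum = (O.take (2*i+2)).sum + 2 with hSd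
  have hS : S ⊆ I := Finset.filter_subset ..
  have ex : ∀ i, (O'.take (2*i)).sum = (O.take (2*i)).sum + dx S i := by
    intro i
    cases i with
    | zero => simp [dx, pr_zero]
    | succ i =>
      have h1 := hx (i+1)
      have h2 := typeC_psum hO (i+1)
      have h3 := typeC_psum h (i+1)
      simp only [dx, pr_succ, hSd, Finset.mem_filter, show 2*(i+1) = 2*i+2 by ring, Nat.add_assoc, Nat.reduceAdd] at *
      by_cases hi : i ∈ I
      · simp only [hi, if_true, true_and] at *
        split_ifs <;> omega
      · simp only [hi, if_false, false_and] at *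
        omega
  refine ⟨S, hS, fun i => ⟨ex i, ?_⟩⟩
  have e0 := ex i
  have e1 : (O'.take (2*i+2)).sum = (O.take (2*i+2)).sum + dx S (i+1) := ex (i+1)
  have y0 := hy i
  have y1 : (O.take (2*i+3)).sum ≤ (O'.take (2*i+3)).sum := (hy (i+1)).1
  have a := psum O (2*i)
  have a' := psum O' (2*i)
  have b : (O.take (2*i+2)).sum = _ := psum O (2*i+1)
  have b' : (O'.take (2*i+2)).sum = _ := psum O' (2*i+1)
  have d : (O.take (2*i+3)).sum = _ := psum O (2*i+2)
  have d' : (O'.take (2*i+3)).sum = _ := psum O' (2*i+2)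
  have t0 := typeC_anti h (2*i)
  have t1 : O'.getD (2*i+2) 0 ≤ O'.getD (2*i+1) 0 := typeC_anti h (2*i+1)
  by_cases hp : pr I i ∧ i ∈ I ∧ O.getD (2*i) 0 = O.getD (2*i+1) 0 + 2
  · have hI : O.getD (2*i+1) 0 = O.getD (2*i+2) 0 := ((D.mem i).1 hp.2.1).2
    have hdy : dy (fun j => O.getD j 0) I i ≤ 1 := by unfold dy; split_ifs <;> omega
    obtain ⟨⟨k, hk, hki⟩, -, hgap⟩ := hp
    have z := (hy k).1
    have c : (O.take (2*i)).sum = (O.take (2*k+1)).sum + O.getD (2*i) 0 := by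
      rw [show 2*i = 2*k+1+1 by omega, psum O (2*k+1)]
      rw [show O.getD (2*k+1) 0 = _ from ((D.mem k).1 hk).2]
    have c' : (O'.take (2*i)).sum = (O'.take (2*k+1)).sum + O'.getD (2*k+1) 0 := by
      rw [show 2*i = 2*k+1+1 by omega, psum O' (2*k+1)]
    have t2 : O'.getD (2*i) 0 ≤ O'.getD (2*k+1) 0 := by
      rw [show 2*i = 2*k+1+1 by omega]; exact typeC_anti h (2*k+1)
    simp only [dx, pr_succ] at e0 e1
    unfold dy
    by_cases p : pr S i
    · by_cases q : i ∈ S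
      · rw [if_pos ⟨p, q, hgap⟩]
        rw [if_pos p] at e0; rw [if_pos q] at e1
        omega
      · rw [if_neg (fun h => q h.2.1)]
        rw [if_pos p] at e0; rw [if_neg q] at e1
        omega
    · rw [if_neg (fun h => p h.1)]
      rw [if_neg p] at e0
      omega
  · have e : dy (fun j => O.getD j 0) I i = 0 := by unfold dy; rw [if_neg hp]
    have e' : dy (fun j => O.getD j 0) S i = 0 := by
      unfold dy; rw [if_neg]
      rintro ⟨⟨k, hk, h1⟩, h2, h3⟩
      exact hp ⟨⟨k, hS hk, h1⟩, hS h2, h3⟩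
    rw [e'] 
    omega

end NI

/-- for a generic type C column sequence `O`, `Norm(O)`
contains a unique member `Olam` all of whose chains have length 2, every
member of `Norm(O)` lies between `O` and `Olam` in the prefix-sum order, and
conversely every type C column sequence of the same total sum lying between
`O` and `Olam` in the prefix-sum order represents the same orbit as some
member of `Norm(O)` (same prefix sums, i.e. equal up to trailing zeros). -/
theorem norm_is_interval (O : List ℕ) (hO : TypeC O) (hg : GenericSeq O) :
    ∃ Olam : List ℕ, NormMem O Olam ∧ (∀ C ∈ chains Olam, C.length = 2) ∧
      (∀ Q, NormMem O Q → (∀ C ∈ chains Q, C.length = 2) → Q = Olam) ∧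
      (∀ O', NormMem O O' → TypeC O' ∧ O'.sum = O.sum ∧
        ∀ j, (O.take j).sum ≤ (O'.take j).sum ∧
          (O'.take j).sum ≤ (Olam.take j).sum) ∧
      (∀ O', TypeC O' → O'.sum = O.sum →
        (∀ j, (O.take j).sum ≤ (O'.take j).sum ∧
          (O'.take j).sum ≤ (Olam.take j).sum) →
        ∃ Q, NormMem O Q ∧ ∀ j, (O'.take j).sum = (Q.take j).sum) := by
  classical
  have D := NI.dat hO hg
  set I := (Finset.range O.length).filter
      fun i => 2*i+3 < O.length ∧ O.getD (2*i+1) 0 = O.getD (2*i+2) 0 with hI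
  obtain ⟨L, hL, RL⟩ := NI.rep_norm D I (subset_refl _)
  have hf : ∀ j, O.getD j 0 = (fun j => O.getD j 0) j := fun _ => rfl
  have sL := RL.sums D (subset_refl _) hf
  refine ⟨L, hL, ?_, ?_, ?_, ?_⟩
  · rw [NI.len2]
    intro i hi
    have h1 := NI.typeC_anti (RL.typeC D (subset_refl _)) (2*i+1)
    rcases lt_or_eq_of_le h1 with h | h
    · exact h
    · have := RL.mem_of_eq D (subset_refl _) i hi h.symm
      exact absurd this.1 this.2
  · intro Q hQ h2
    obtain ⟨S, hS, R⟩ := NI.norm_rep D hQ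
    rw [NI.len2] at h2
    have : S = I := by
      apply Finset.Subset.antisymm hS
      intro i hi
      by_contra hn
      obtain ⟨h3, h4⟩ := R.ready D i hi hn
      have := h2 i h3
      omega
    subst this
    exact R.get_eq RL
  · intro Q hQ
    obtain ⟨S, hS, R⟩ := NI.norm_rep D hQ
    have sQ := R.sums D hS hf
    refine ⟨R.typeC D hS, ?_, ?_⟩
    · have h := (sQ (O.length + Q.length + 1)).1
      rw [List.take_of_length_le (by omega), List.take_of_length_le (by omega)] at h
      rw [h, NI.dx, if_neg]; · rfl
      rw [NI.pr_succ]
      intro hm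
      have := ((D.mem _).1 (hS hm)).1
      omega
    · have hpr : ∀ i, NI.pr S i → NI.pr I i := by
        rintro i ⟨k, hk, h⟩; exact ⟨k, hS hk, h⟩
      intro j
      rcases Nat.even_or_odd' j with ⟨i, rfl | rfl⟩
      · rw [(sQ i).1, (sL i).1]
        refine ⟨by omega, ?_⟩
        unfold NI.dx
        by_cases h : NI.pr S i
        · rw [if_pos h, if_pos (hpr i h)]
        · rw [if_neg h]; omega
      · rw [(sQ i).2, (sL i).2]
        refine ⟨by omega, ?_⟩
        unfold NI.dy
        by_cases h : NI.pr S i ∧ i ∈ S ∧ O.getD (2*i) 0 = O.getD (2*i+1) 0 + 2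
        · rw [if_pos h, if_pos ⟨hpr i h.1, hS h.2.1, h.2.2⟩]
        · rw [if_neg h]; omega
  · intro O' hO' _ hb
    obtain ⟨S, hS, hs⟩ := NI.between (O' := O') D hO hO'
      (fun i => by rw [← (sL i).1]; exact hb _) (fun i => by rw [← (sL i).2]; exact hb _)
    obtain ⟨Q, hQ, R⟩ := NI.rep_norm D S hS
    have sQ := R.sums D hS hf
    refine ⟨Q, hQ, fun j => ?_⟩
    rcases Nat.even_or_odd' j with ⟨i, rfl | rfl⟩
    · rw [(sQ i).1, (hs i).1]
    · rw [(sQ i).2, (hs i).2]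
end
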